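/- Let (ℰ,𝓕) be a regular resistance form on a nonempty set F whose resistance metric R makes (F,R) a compact metric space. For x ∈ F and ε > 0, let B̄(x,ε) := {w ∈ F : R(x,w) ≤ ε}. Then for all x, y, z ∈ F and all ε > 0, g_{{x}}(y,z) − 2ε ≤ g_{B̄(x,ε)}(y,z) ≤ g_{{x}}(y,z), where g_A denotes the resolvent kernel associated to a nonempty set A. -/

import Mathlib

open Filter Topology MeasureTheory
open scoped ENNReal

/-- A resistance form `(ℰ,𝓕)` on a nonempty set `F`:
`dom` is a linear subspace of `F → ℝ` containing the constants, and `energy`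
is a nonnegative symmetric bilinear form satisfying RF1–RF5. -/
structure ResistanceForm (F : Type*) where
  dom : Set (F → ℝ)
  energy : (F → ℝ) → (F → ℝ) → ℝ
  const_mem : ∀ c : ℝ, (fun _ => c) ∈ dom
  add_mem : ∀ f ∈ dom, ∀ g ∈ dom, f + g ∈ dom
  smul_mem : ∀ (c : ℝ), ∀ f ∈ dom, c • f ∈ dom
  symm : ∀ f g, energy f g = energy g f
  add_left : ∀ f g h, energy (f + g) h = energy f h + energy g h
  smul_left : ∀ (c : ℝ) (f g), energy (c • f) g = c * energy f g
  nonneg : ∀ f ∈ dom, 0 ≤ energy f f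
  -- RF1: `ℰ(f,f) = 0` iff `f` is constant
  rf1 : ∀ f ∈ dom, (energy f f = 0 ↔ ∃ c : ℝ, ∀ x, f x = c)
  -- RF2: the quotient of `dom` by the constants is complete (hence a Hilbert space)
  rf2 : ∀ f : ℕ → F → ℝ, (∀ n, f n ∈ dom) →
    (∀ ε > (0:ℝ), ∃ N, ∀ m ≥ N, ∀ n ≥ N, energy (f m - f n) (f m - f n) < ε) →
    ∃ g ∈ dom, Tendsto (fun n => energy (f n - g) (f n - g)) atTop (𝓝 0)
  -- RF3: `dom` separates points
  rf3 : ∀ x y : F, x ≠ y → ∃ f ∈ dom, f x ≠ f y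
  -- RF4: the resistance between two points is finite
  rf4 : ∀ x y : F,
    BddAbove {r : ℝ | ∃ f ∈ dom, 0 < energy f f ∧ r = |f x - f y| ^ 2 / energy f f}
  -- RF5: the Markov property
  rf5 : ∀ f ∈ dom, (fun x => max (min (f x) 1) 0) ∈ dom ∧
    energy (fun x => max (min (f x) 1) 0) (fun x => max (min (f x) 1) 0) ≤ energy f f

namespace ResistanceForm

variable {F : Type*} (Φ : ResistanceForm F)

/-- The resistance metric `R(x,y)`. -/
noncomputable def Rmet (x y : F) : ℝ :=
  sSup {r : ℝ | ∃ f ∈ Φ.dom, 0 < Φ.energy f f ∧ r = |f x - f y| ^ 2 / Φ.energy f f}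

/-- The effective resistance `R(x,A)` between a point and a set, valued in `[0,∞]`,
with `sInf ∅ = ∞`, `∞⁻¹ = 0` and `0⁻¹ = ∞`. -/
noncomputable def resToSet (x : F) (A : Set F) : ℝ≥0∞ :=
  (sInf {e : ℝ≥0∞ | ∃ f ∈ Φ.dom, f x = 1 ∧ (∀ y ∈ A, f y = 0) ∧
    e = ENNReal.ofReal (Φ.energy f f)})⁻¹

/-- The open ball of radius `r` about `x` in the resistance metric. -/
def ball (x : F) (r : ℝ) : Set F := {y | Φ.Rmet x y < r}

end ResistanceForm

namespace ResistanceForm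

variable {F : Type*} (Φ : ResistanceForm F)

/-- `R_A(y,z)`: the resistance between `y` and `z` in the network with `A` fused,
`sup{ ℰ(f,f)⁻¹ : f ∈ 𝓕, f(y) = 1, f(z) = 0, f constant on A }` (with `sSup ∅ = 0`). -/
noncomputable def fusedRes (A : Set F) (y z : F) : ℝ :=
  sSup {r : ℝ | ∃ f ∈ Φ.dom, f y = 1 ∧ f z = 0 ∧
    (∀ a ∈ A, ∀ b ∈ A, f a = f b) ∧ r = (Φ.energy f f)⁻¹}

/-- The resolvent kernel `g_A(y,z) = (R(y,A) + R(z,A) - R_A(y,z))/2`. -/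
noncomputable def resKernel (A : Set F) (y z : F) : ℝ :=
  ((Φ.resToSet y A).toReal + (Φ.resToSet z A).toReal - Φ.fusedRes A y z) / 2

/-- Regularity of a resistance form: `𝓕 ∩ C₀(F)` is dense in `C₀(F)` in the
supremum norm, where the topology on `F` is that of the resistance metric. -/
def Regular [MetricSpace F] : Prop :=
  ∀ g : F → ℝ, Continuous g → HasCompactSupport g → ∀ ε > (0:ℝ),
    ∃ f ∈ Φ.dom, Continuous f ∧ HasCompactSupport f ∧ ∀ x, |f x - g x| ≤ ε

end ResistanceForm

namespace ResistanceForm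

variable {F : Type*} (Φ : ResistanceForm F)

lemma sub_mem {f g : F → ℝ} (hf : f ∈ Φ.dom) (hg : g ∈ Φ.dom) : f - g ∈ Φ.dom := by
  have h := Φ.add_mem f hf _ (Φ.smul_mem (-1) g hg)
  rwa [neg_one_smul, ← sub_eq_add_neg] at h

lemma energy_add_self (f g : F → ℝ) :
    Φ.energy (f + g) (f + g) = Φ.energy f f + 2 * Φ.energy f g + Φ.energy g g := by
  rw [Φ.add_left, Φ.symm f, Φ.symm g, Φ.add_left, Φ.add_left, Φ.symm g f]
  ring

lemma energy_smul_self (c : ℝ) (f : F → ℝ) :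
    Φ.energy (c • f) (c • f) = c ^ 2 * Φ.energy f f := by
  rw [Φ.smul_left, Φ.symm f, Φ.smul_left]
  ring

lemma energy_const_right {f : F → ℝ} (hf : f ∈ Φ.dom) (c : ℝ) :
    Φ.energy f (fun _ => c) = 0 := by
  have hc := Φ.const_mem c
  have h0 : Φ.energy (fun _ => c) (fun _ => c) = 0 := (Φ.rf1 _ hc).2 ⟨c, fun _ => rfl⟩
  set b := Φ.energy f (fun _ => c) with hb
  have key (t : ℝ) : 0 ≤ Φ.energy f f + 2 * (t * b) := by
    have h := Φ.nonneg _ (Φ.add_mem _ hf _ (Φ.smul_mem t _ hc))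
    rwa [energy_add_self, energy_smul_self, h0, Φ.symm f (t • _), Φ.smul_left,
      Φ.symm (fun _ => c) f,
      ← hb, mul_zero, add_zero] at h
  by_contra hne
  have h := key (-(Φ.energy f f + 1) / b)
  rw [div_mul_cancel₀ _ hne] at h
  linarith [Φ.nonneg f hf]

lemma energy_add_const {f : F → ℝ} (hf : f ∈ Φ.dom) (c : ℝ) :
    Φ.energy (fun w => f w + c) (fun w => f w + c) = Φ.energy f f := by
  have h := Φ.energy_add_self f (fun _ => c)
  rwa [Φ.energy_const_right hf, (Φ.rf1 _ (Φ.const_mem c)).2 ⟨c, fun _ => rfl⟩, mul_zero,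
    add_zero, add_zero] at h

lemma add_const_mem {f : F → ℝ} (hf : f ∈ Φ.dom) (c : ℝ) : (fun w => f w + c) ∈ Φ.dom :=
  Φ.add_mem _ hf _ (Φ.const_mem c)

/-- The functions in the domain that vanish at `x`. -/
def pinnedSubmodule (x : F) : Submodule ℝ (F → ℝ) where
  carrier := {f | f ∈ Φ.dom ∧ f x = 0}
  add_mem' := fun {f g} hf hg => ⟨Φ.add_mem f hf.1 g hg.1, by simp [hf.2, hg.2]⟩
  zero_mem' := ⟨Φ.const_mem 0, rfl⟩
  smul_mem' := fun c f hf => ⟨Φ.smul_mem c f hf.1, by simp [hf.2]⟩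

/-- The functions in the domain that vanish at `x`, as a type carrying the energy norm
rather than the topology of pointwise convergence. -/
def Pinned (x : F) : Type _ := Φ.pinnedSubmodule x

noncomputable instance (x : F) : AddCommGroup (Φ.Pinned x) :=
  inferInstanceAs (AddCommGroup (Φ.pinnedSubmodule x))

noncomputable instance (x : F) : Module ℝ (Φ.Pinned x) :=
  inferInstanceAs (Module ℝ (Φ.pinnedSubmodule x))

/-- The energy as an inner product on the functions vanishing at `x`. -/
@[reducible] noncomputable def pinnedCore (x : F) : InnerProductSpace.Core ℝ (Φ.Pinned x) where
  inner f g := Φ.energy f.1 g.1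
  conj_inner_symm f g := Φ.symm _ _
  re_inner_nonneg f := Φ.nonneg _ f.2.1
  add_left f g h := Φ.add_left _ _ _
  smul_left f g c := Φ.smul_left _ _ _
  definite f hf := by
    obtain ⟨c, hc⟩ := (Φ.rf1 _ f.2.1).1 hf
    apply Subtype.ext
    funext w
    exact (hc w).trans ((hc x).symm.trans f.2.2)

noncomputable instance (x : F) : NormedAddCommGroup (Φ.Pinned x) :=
  (Φ.pinnedCore x).toNormedAddCommGroup

noncomputable instance (x : F) : InnerProductSpace ℝ (Φ.Pinned x) :=
  InnerProductSpace.ofCore (Φ.pinnedCore x).toCore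

namespace Pinned

variable {Φ} {x : F}

lemma norm_sq (f : Φ.Pinned x) : ‖f‖ ^ 2 = Φ.energy f.1 f.1 :=
  (real_inner_self_eq_norm_sq f).symm

lemma sub_val (f g : Φ.Pinned x) : (f - g).1 = f.1 - g.1 := rfl

/-- Subtracting its value at `x` from a function of the domain. -/
def ofDom {f : F → ℝ} (hf : f ∈ Φ.dom) : Φ.Pinned x :=
  ⟨fun w => f w + -f x, Φ.add_const_mem hf _, by simp⟩

lemma norm_sq_ofDom {f : F → ℝ} (hf : f ∈ Φ.dom) :
    ‖(ofDom hf : Φ.Pinned x)‖ ^ 2 = Φ.energy f f := by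
  rw [norm_sq]
  exact Φ.energy_add_const hf _

instance : CompleteSpace (Φ.Pinned x) := by
  refine Metric.complete_of_cauchySeq_tendsto fun u hu => ?_
  obtain ⟨g, hg, hlim⟩ := Φ.rf2 (fun n => (u n).1) (fun n => (u n).2.1) (by
    intro ε hε
    obtain ⟨N, hN⟩ := Metric.cauchySeq_iff.1 hu (√ε) (Real.sqrt_pos.2 hε)
    refine ⟨N, fun m hm n hn => ?_⟩
    have h := hN m hm n hn
    rw [dist_eq_norm, Real.lt_sqrt (norm_nonneg _), norm_sq, sub_val] at h
    exact h)
  refine ⟨ofDom hg, tendsto_iff_norm_sub_tendsto_zero.2 ?_⟩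
  have hsq (n : ℕ) : ‖u n - ofDom hg‖ = √(Φ.energy ((u n).1 - g) ((u n).1 - g)) := by
    rw [← Real.sqrt_sq (norm_nonneg _), norm_sq,
      ← Φ.energy_add_const (Φ.sub_mem (u n).2.1 hg) (g x)]
    have heq : (u n - ofDom hg).1 = fun w => ((u n).1 - g) w + g x := by
      funext w
      change (u n).1 w - (g w + -g x) = (u n).1 w - g w + g x
      ring
    rw [heq]
  simp_rw [hsq]
  simpa using hlim.sqrt

lemma exists_eval_bound (x y : F) : ∃ M : ℝ, ∀ f : Φ.Pinned x, |f.1 y| ≤ M * ‖f‖ := by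
  obtain ⟨M, hM⟩ := Φ.rf4 y x
  refine ⟨√M, fun f => ?_⟩
  rcases eq_or_ne f 0 with rfl | hf
  · rw [norm_zero, mul_zero]
    exact (abs_zero).le
  have hpos : 0 < Φ.energy f.1 f.1 := by
    rw [← norm_sq]
    positivity
  have h := hM ⟨f.1, f.2.1, hpos, rfl⟩
  rw [f.2.2, sub_zero, div_le_iff₀ hpos, ← norm_sq] at h
  rw [← Real.sqrt_sq (abs_nonneg (f.1 y)), ← Real.sqrt_sq (norm_nonneg f),
    ← Real.sqrt_mul' _ (sq_nonneg _)]
  exact Real.sqrt_le_sqrt h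

/-- Evaluation at `y` as a continuous linear functional. -/
noncomputable def pointEval (x y : F) : Φ.Pinned x →L[ℝ] ℝ :=
  LinearMap.mkContinuousOfExistsBound
    { toFun := fun f => f.1 y
      map_add' := fun _ _ => rfl
      map_smul' := fun _ _ => rfl } (exists_eval_bound x y)

/-- The function representing evaluation at `y` in the energy inner product. -/
noncomputable def green (x y : F) : Φ.Pinned x :=
  (InnerProductSpace.toDual ℝ (Φ.Pinned x)).symm (pointEval x y)

lemma inner_green (y : F) (f : Φ.Pinned x) : inner ℝ (green x y) f = f.1 y :=
  InnerProductSpace.toDual_symm_apply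

/-- The functions that vanish on `A`. -/
def vanishing (x : F) (A : Set F) : Submodule ℝ (Φ.Pinned x) where
  carrier := {f | ∀ a ∈ A, f.1 a = 0}
  add_mem' := fun {f g} hf hg a ha => by
    change f.1 a + g.1 a = 0
    rw [hf a ha, hg a ha, add_zero]
  zero_mem' := fun _ _ => rfl
  smul_mem' := fun c f hf a ha => by
    change c * f.1 a = 0
    rw [hf a ha, mul_zero]

lemma isClosed_vanishing (A : Set F) :
    IsClosed ((vanishing x A : Submodule ℝ (Φ.Pinned x)) : Set (Φ.Pinned x)) := by
  have h : ((vanishing x A : Submodule ℝ (Φ.Pinned x)) : Set (Φ.Pinned x)) =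
      ⋂ a ∈ A, {f | pointEval x a f = 0} := by
    ext f
    simp only [Set.mem_iInter]
    rfl
  rw [h]
  exact isClosed_biInter fun a _ => isClosed_eq (pointEval x a).continuous continuous_const

instance (A : Set F) : CompleteSpace (vanishing x A : Submodule ℝ (Φ.Pinned x)) :=
  (isClosed_vanishing A).completeSpace_coe

end Pinned

section Hilbert

variable {H : Type*} [NormedAddCommGroup H] [InnerProductSpace ℝ H]
  (K : Submodule ℝ H) [K.HasOrthogonalProjection] (v : H)

lemma inner_starProjection_of_mem {f : H} (hf : f ∈ K) :
    inner ℝ (K.starProjection v) f = inner ℝ v f := by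
  rw [Submodule.inner_starProjection_left_eq_right, Submodule.starProjection_eq_self_iff.2 hf]

lemma starProjection_ne_zero_of_inner_eq_one {f : H} (hf : f ∈ K) (h : inner ℝ v f = (1 : ℝ)) :
    K.starProjection v ≠ 0 := by
  intro h0
  rw [← inner_starProjection_of_mem K v hf, h0, inner_zero_left] at h
  exact zero_ne_one h

lemma inv_norm_sq_le_of_inner_eq_one {f : H} (hf : f ∈ K) (h : inner ℝ v f = (1 : ℝ)) :
    (‖K.starProjection v‖ ^ 2)⁻¹ ≤ ‖f‖ ^ 2 := by
  have hp := norm_pos_iff.2 (starProjection_ne_zero_of_inner_eq_one K v hf h)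
  have h1 := real_inner_le_norm (K.starProjection v) f
  rw [inner_starProjection_of_mem K v hf, h] at h1
  rw [inv_le_iff_one_le_mul₀ (by positivity), mul_comm, ← mul_pow]
  exact one_le_pow₀ h1

lemma exists_inner_eq_one_norm_sq (h : K.starProjection v ≠ 0) :
    ∃ f ∈ K, inner ℝ v f = (1 : ℝ) ∧ ‖f‖ ^ 2 = (‖K.starProjection v‖ ^ 2)⁻¹ := by
  set p := K.starProjection v with hp
  have hpK : p ∈ K := Submodule.starProjection_apply_mem K v
  have hn : ‖p‖ ≠ 0 := norm_ne_zero_iff.2 h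
  refine ⟨(‖p‖ ^ 2)⁻¹ • p, K.smul_mem _ hpK, ?_, ?_⟩
  · rw [inner_smul_right, ← inner_starProjection_of_mem K v hpK, ← hp,
      real_inner_self_eq_norm_sq]
    field_simp
  · rw [norm_smul, mul_pow, Real.norm_eq_abs, sq_abs]
    field_simp

lemma toReal_inv_sInf_norm_sq :
    (sInf {e : ℝ≥0∞ | ∃ f ∈ K, inner ℝ v f = (1 : ℝ) ∧ e = ENNReal.ofReal (‖f‖ ^ 2)})⁻¹.toReal =
      ‖K.starProjection v‖ ^ 2 := by
  by_cases h : K.starProjection v = 0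
  · rw [Set.eq_empty_of_forall_notMem (s := {e : ℝ≥0∞ | _})]
    · simp [h]
    · rintro e ⟨f, hf, h1, -⟩
      exact starProjection_ne_zero_of_inner_eq_one K v hf h1 h
  · obtain ⟨f, hf, h1, h2⟩ := exists_inner_eq_one_norm_sq K v h
    have hl : IsLeast {e : ℝ≥0∞ | ∃ f ∈ K, inner ℝ v f = (1 : ℝ) ∧ e = ENNReal.ofReal (‖f‖ ^ 2)}
        (ENNReal.ofReal (‖K.starProjection v‖ ^ 2)⁻¹) := by
      refine ⟨⟨f, hf, h1, by rw [h2]⟩, ?_⟩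
      rintro e ⟨f, hf, h1, rfl⟩
      exact ENNReal.ofReal_le_ofReal (inv_norm_sq_le_of_inner_eq_one K v hf h1)
    rw [hl.csInf_eq, ENNReal.toReal_inv, ENNReal.toReal_ofReal (by positivity), inv_inv]

lemma sSup_inv_norm_sq :
    sSup {r : ℝ | ∃ f ∈ K, inner ℝ v f = (1 : ℝ) ∧ r = (‖f‖ ^ 2)⁻¹} =
      ‖K.starProjection v‖ ^ 2 := by
  by_cases h : K.starProjection v = 0
  · rw [Set.eq_empty_of_forall_notMem (s := {r : ℝ | _})]
    · simp [h]
    · rintro e ⟨f, hf, h1, -⟩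
      exact starProjection_ne_zero_of_inner_eq_one K v hf h1 h
  · obtain ⟨f, hf, h1, h2⟩ := exists_inner_eq_one_norm_sq K v h
    refine IsGreatest.csSup_eq ⟨⟨f, hf, h1, by rw [h2, inv_inv]⟩, ?_⟩
    rintro r ⟨f, hf, h1, rfl⟩
    have hp := norm_pos_iff.2 h
    exact inv_le_of_inv_le₀ (by positivity) (inv_norm_sq_le_of_inner_eq_one K v hf h1)

lemma sSup_inner_sq_div_norm_sq :
    sSup {r : ℝ | ∃ f : H, 0 < ‖f‖ ^ 2 ∧ r = |inner ℝ v f| ^ 2 / ‖f‖ ^ 2} = ‖v‖ ^ 2 := by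
  have hle {r : ℝ} (hr : ∃ f : H, 0 < ‖f‖ ^ 2 ∧ r = |inner ℝ v f| ^ 2 / ‖f‖ ^ 2) :
      r ≤ ‖v‖ ^ 2 := by
    obtain ⟨f, hf, rfl⟩ := hr
    rw [div_le_iff₀ hf, ← mul_pow]
    exact pow_le_pow_left₀ (abs_nonneg _) (abs_real_inner_le_norm v f) 2
  by_cases h : v = 0
  · refine le_antisymm (Real.sSup_le (fun r hr => hle hr) (sq_nonneg _)) ?_
    rw [h, norm_zero, zero_pow two_ne_zero]
    refine Real.sSup_nonneg ?_
    rintro r ⟨f, -, rfl⟩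
    positivity
  · have hn := norm_pos_iff.2 h
    refine IsGreatest.csSup_eq ⟨⟨v, by positivity, ?_⟩, fun r hr => hle hr⟩
    rw [real_inner_self_eq_norm_sq, abs_of_nonneg (sq_nonneg _)]
    field_simp

end Hilbert

open Pinned

lemma toReal_resToSet {x : F} {A : Set F} (hx : x ∈ A) (y : F) :
    (Φ.resToSet y A).toReal =
      ‖(vanishing x A).starProjection (green x y : Φ.Pinned x)‖ ^ 2 := by
  rw [← toReal_inv_sInf_norm_sq, resToSet]
  congr 3
  ext e
  constructor
  · rintro ⟨f, hf, h1, hA, rfl⟩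
    let t : Φ.Pinned x := ⟨f, hf, hA x hx⟩
    exact ⟨t, hA, (inner_green y t).trans h1, congrArg ENNReal.ofReal (norm_sq t).symm⟩
  · rintro ⟨f, hf, h1, rfl⟩
    exact ⟨f.1, f.2.1, (inner_green _ _).symm.trans h1, hf, by rw [norm_sq]⟩

lemma fusedRes_eq {x : F} {A : Set F} (hx : x ∈ A) (y z : F) :
    Φ.fusedRes A y z =
      ‖(vanishing x A).starProjection (green x y - green x z : Φ.Pinned x)‖ ^ 2 := by
  rw [← sSup_inv_norm_sq, fusedRes]
  congr 1
  ext r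
  constructor
  · rintro ⟨f, hf, h1, h0, hA, rfl⟩
    refine ⟨ofDom hf, fun a ha => ?_, ?_, by rw [norm_sq_ofDom]⟩
    · change f a + -f x = 0
      rw [hA a ha x hx, add_neg_cancel]
    · rw [inner_sub_left, inner_green, inner_green]
      simp [ofDom, h1, h0]
  · rintro ⟨f, hf, h1, rfl⟩
    rw [inner_sub_left, inner_green, inner_green] at h1
    refine ⟨fun w => f.1 w + -f.1 z, Φ.add_const_mem f.2.1 _, by linarith, by ring,
      fun a ha b hb => by simp only [hf a ha, hf b hb], ?_⟩
    rw [Φ.energy_add_const f.2.1, norm_sq]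

lemma Rmet_eq (x y z : F) :
    Φ.Rmet y z = ‖(green x y - green x z : Φ.Pinned x)‖ ^ 2 := by
  rw [← sSup_inner_sq_div_norm_sq, Rmet]
  congr 1
  ext r
  constructor
  · rintro ⟨f, hf, hpos, rfl⟩
    refine ⟨ofDom hf, by rwa [norm_sq_ofDom], ?_⟩
    rw [inner_sub_left, inner_green, inner_green, norm_sq_ofDom]
    simp [ofDom]
  · rintro ⟨f, hpos, rfl⟩
    rw [norm_sq] at hpos
    exact ⟨f.1, f.2.1, hpos, by rw [inner_sub_left, inner_green, inner_green, norm_sq]⟩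

lemma green_self (x : F) : (green x x : Φ.Pinned x) = 0 := by
  rw [← inner_self_eq_zero (𝕜 := ℝ), inner_green]
  exact (green x x : Φ.Pinned x).2.2

lemma inner_green_green (x y z : F) :
    inner ℝ (green x y : Φ.Pinned x) (green x z) =
      (Φ.Rmet x y + Φ.Rmet x z - Φ.Rmet y z) / 2 := by
  rw [Φ.Rmet_eq x x y, Φ.Rmet_eq x x z, Φ.Rmet_eq x y z, green_self, zero_sub, zero_sub,
    norm_neg, norm_neg, norm_sub_sq_real]
  ring

/-- The resolvent kernel is the reproducing kernel of the functions vanishing on `A`. -/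
lemma resKernel_eq {x : F} {A : Set F} (hx : x ∈ A) (y z : F) :
    Φ.resKernel A y z =
      ((vanishing x A).starProjection (green x y : Φ.Pinned x)).1 z := by
  rw [resKernel, Φ.toReal_resToSet hx, Φ.toReal_resToSet hx, Φ.fusedRes_eq hx, map_sub,
    norm_sub_sq_real, Submodule.inner_starProjection_left_eq_right,
    Submodule.starProjection_eq_self_iff.2 (Submodule.starProjection_apply_mem _ _),
    ← Submodule.inner_starProjection_left_eq_right, real_inner_comm, inner_green]
  ring

lemma truncation_mem {f : F → ℝ} (hf : f ∈ Φ.dom) {c : ℝ} (hc : 0 < c) :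
    (fun w => max (min (f w) c) 0) ∈ Φ.dom ∧
      Φ.energy (fun w => max (min (f w) c) 0) (fun w => max (min (f w) c) 0) ≤
        Φ.energy f f := by
  obtain ⟨h1, h2⟩ := Φ.rf5 _ (Φ.smul_mem c⁻¹ f hf)
  have heq : (fun w => max (min (f w) c) 0) =
      c • fun w => max (min ((c⁻¹ • f) w) 1) 0 := by
    funext w
    simp only [Pi.smul_apply, smul_eq_mul]
    rw [mul_max_of_nonneg _ _ hc.le, mul_min_of_nonneg _ _ hc.le, mul_inv_cancel_left₀ hc.ne',
      mul_one, mul_zero]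
  rw [heq]
  refine ⟨Φ.smul_mem _ _ h1, ?_⟩
  rw [energy_smul_self] at h2 ⊢
  calc _ ≤ c ^ 2 * (c⁻¹ ^ 2 * Φ.energy f f) := by gcongr
    _ = _ := by field_simp

/-- The maximum principle for functions that are harmonic off `A`. -/
lemma mem_Icc_of_orthogonal {x : F} {A : Set F} (hx : x ∈ A) {c : ℝ} (hc : 0 < c)
    {h : Φ.Pinned x} (horth : h ∈ (vanishing x A)ᗮ) (hA : ∀ a ∈ A, h.1 a ∈ Set.Icc 0 c)
    (z : F) : h.1 z ∈ Set.Icc 0 c := by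
  obtain ⟨hmem, hle⟩ := Φ.truncation_mem h.2.1 hc
  have hAeq (a : F) (ha : a ∈ A) : max (min (h.1 a) c) 0 = h.1 a := by
    rw [min_eq_left (hA a ha).2, max_eq_left (hA a ha).1]
  let t : Φ.Pinned x := ⟨fun w => max (min (h.1 w) c) 0, hmem, (hAeq x hx).trans h.2.2⟩
  have hd : t - h ∈ vanishing x A := fun a ha => sub_eq_zero.2 (hAeq a ha)
  have h0 : inner ℝ (t - h) h = (0 : ℝ) := horth _ hd
  have ht : ‖t‖ ^ 2 ≤ ‖h‖ ^ 2 := by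
    rw [norm_sq, norm_sq]
    exact hle
  have hsq : ‖t - h‖ ^ 2 ≤ 0 := by
    rw [inner_sub_left, real_inner_self_eq_norm_sq] at h0
    rw [norm_sub_sq_real]
    linarith
  have heq : t = h := by
    rw [← sub_eq_zero, ← norm_eq_zero]
    exact pow_eq_zero_iff two_ne_zero |>.1 (le_antisymm hsq (sq_nonneg _))
  have hz : max (min (h.1 z) c) 0 = h.1 z := congrArg (fun f : Φ.Pinned x => f.1 z) heq
  rw [← hz]
  exact ⟨le_max_right _ _, max_le (min_le_right _ _) hc.le⟩

end ResistanceForm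

/-- for a regular resistance form on a compact space,
`g_{{x}}(y,z) - 2ε ≤ g_{B̄(x,ε)}(y,z) ≤ g_{{x}}(y,z)`. -/
theorem resKernel_closedBall_approx
    {F : Type*} [Nonempty F] [MetricSpace F] [CompactSpace F]
    (Φ : ResistanceForm F) (hdist : ∀ x y : F, dist x y = Φ.Rmet x y)
    (hreg : Φ.Regular) (x y z : F) (ε : ℝ) (hε : 0 < ε) :
    Φ.resKernel {x} y z - 2 * ε ≤ Φ.resKernel {w | Φ.Rmet x w ≤ ε} y z ∧
      Φ.resKernel {w | Φ.Rmet x w ≤ ε} y z ≤ Φ.resKernel {x} y z := by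
  have hself : Φ.Rmet x x = 0 := by rw [← hdist, dist_self]
  have hx : x ∈ {w | Φ.Rmet x w ≤ ε} := by
    rw [Set.mem_ofPred_eq, hself]
    exact hε.le
  set B := {w | Φ.Rmet x w ≤ ε}
  let k : Φ.Pinned x := ResistanceForm.Pinned.green x y
  let K : Submodule ℝ (Φ.Pinned x) := ResistanceForm.Pinned.vanishing x B
  have hsingle (w : F) : Φ.resKernel {x} y w = k.1 w := by
    rw [Φ.resKernel_eq (Set.mem_singleton x), Submodule.starProjection_eq_self_iff.2]
    rintro a rfl
    exact k.2.2
  have hB : ∀ b ∈ B, (k - K.starProjection k).1 b ∈ Set.Icc 0 ε := by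
    intro b hb
    have hPb : (K.starProjection k).1 b = 0 := Submodule.starProjection_apply_mem K k b hb
    have hkb : k.1 b = (Φ.Rmet x y + Φ.Rmet x b - Φ.Rmet y b) / 2 := by
      rw [← Φ.inner_green_green, real_inner_comm, ResistanceForm.Pinned.inner_green]
    have hb' : Φ.Rmet x b ≤ ε := hb
    rw [ResistanceForm.Pinned.sub_val, Pi.sub_apply, hPb, hkb, sub_zero]
    rw [← hdist] at hb'
    rw [← hdist, ← hdist, ← hdist]
    constructor
    · linarith [dist_triangle_left y b x]
    · linarith [dist_triangle_right x y b, dist_comm y b]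
  have hz := Φ.mem_Icc_of_orthogonal hx hε (Submodule.sub_starProjection_mem_orthogonal k) hB z
  rw [ResistanceForm.Pinned.sub_val, Pi.sub_apply] at hz
  rw [hsingle, Φ.resKernel_eq hx]
  constructor
  · linarith [hz.2]
  · linarith [hz.1]
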